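/- arXiv:1604.06791 — 2 statements merged into one kernel-verified Lean document; each statement's English description precedes it below -/
import Mathlib

section
/- Dyadic testing implies strong type for the harmonic maximal operator: let 0 < p < ∞ and (u, σ) be weights satisfying the testing condition ∫_Q (M^𝖣_{-1}(1_Q σ^{-1}))^p u ≤ C ∫_Q σ for all dyadic cubes Q. Then ∫_{ℝ^n} (M^𝖣_{-1}(f σ^{-1}))^p u ≤ C' ∫_{ℝ^n} |f|^p σ for all f ∈ L^p(σ). -/
open MeasureTheory Set ENNReal Filter

/-- A dyadic grid in `ℝⁿ`: every member is a half-open cube of sidelength `2^k`,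
any two members are nested or disjoint, and for each `k` the cubes of
sidelength `2^k` cover `ℝⁿ`. -/
def IsDyadicGrid {n : ℕ} (𝒟 : Set (Set (Fin n → ℝ))) : Prop :=
  (∀ Q ∈ 𝒟, ∃ (k : ℤ) (a : Fin n → ℝ),
      Q = Set.univ.pi fun i => Set.Ico (a i) (a i + (2 : ℝ) ^ k)) ∧
  (∀ Q ∈ 𝒟, ∀ P ∈ 𝒟, Q ∩ P = ∅ ∨ Q ∩ P = Q ∨ Q ∩ P = P) ∧
  (∀ (k : ℤ) (x : Fin n → ℝ), ∃ Q ∈ 𝒟, x ∈ Q ∧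
      ∃ a : Fin n → ℝ, Q = Set.univ.pi fun i => Set.Ico (a i) (a i + (2 : ℝ) ^ k))

/-- The harmonic maximal operator over a family `𝓑`, applied to
`g : ℝⁿ → ℝ≥0∞`: `M₋₁^𝓑 g(x) = sup_{B ∈ 𝓑, x ∈ B} (⨍_B g⁻¹)⁻¹`, with the
conventions `1/0 = ∞`, `1/∞ = 0` built into `ℝ≥0∞`. -/
noncomputable def harmMax {n : ℕ} (𝓑 : Set (Set (Fin n → ℝ)))
    (g : (Fin n → ℝ) → ℝ≥0∞) (x : Fin n → ℝ) : ℝ≥0∞ :=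
  ⨆ (B ∈ 𝓑) (_ : x ∈ B), ((volume B)⁻¹ * ∫⁻ y in B, (g y)⁻¹)⁻¹

lemma hm_grid_countable {n : ℕ} {𝒟 : Set (Set (Fin n → ℝ))} (hD : IsDyadicGrid 𝒟) :
    𝒟.Countable := by
  obtain ⟨h1, h2, -⟩ := hD
  have hsub : 𝒟 ⊆ ⋃ k : ℤ, {Q | Q ∈ 𝒟 ∧ ∃ a : Fin n → ℝ,
      Q = Set.univ.pi fun i => Set.Ico (a i) (a i + (2 : ℝ) ^ k)} := by
    intro Q hQ
    obtain ⟨k, a, h⟩ := h1 Q hQ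
    exact Set.mem_iUnion.2 ⟨k, hQ, a, h⟩
  refine Set.Countable.mono hsub (Set.countable_iUnion fun k => ?_)
  have hk : (0 : ℝ) < 2 ^ k := by positivity
  have key : ∀ a b : Fin n → ℝ,
      (Set.univ.pi fun i => Set.Ico (a i) (a i + (2 : ℝ) ^ k)) ⊆
      (Set.univ.pi fun i => Set.Ico (b i) (b i + (2 : ℝ) ^ k)) → a = b := by
    intro a b hab
    rw [Set.univ_pi_subset_univ_pi_iff] at hab
    rcases hab with hab | ⟨i, hi⟩
    · funext i
      have := (Set.Ico_subset_Ico_iff (by linarith)).1 (hab i)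
      linarith [this.1, this.2]
    · rw [Set.Ico_eq_empty_iff] at hi
      exact absurd (by linarith) hi
  refine Set.PairwiseDisjoint.countable_of_nonempty_interior (s := id) ?_ ?_
  · rintro Q ⟨hQ, a, ha⟩ P ⟨hP, b, hb⟩ hne
    change Disjoint Q P
    rw [Set.disjoint_iff_inter_eq_empty]
    rcases h2 Q hQ P hP with h | h | h
    · exact h
    · have h' : Q ⊆ P := Set.inter_eq_left.1 h
      exfalso; apply hne
      rw [ha, hb] at h'
      rw [ha, hb, key a b h']
    · have h' : P ⊆ Q := Set.inter_eq_right.1 h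
      exfalso; apply hne
      rw [ha, hb] at h'
      rw [ha, hb, key b a h']
  · rintro Q ⟨hQ, a, ha⟩
    refine ⟨fun i => a i + 2 ^ k / 2, ?_⟩
    simp only [id]
    rw [ha, interior_pi_set Set.finite_univ]
    intro i _
    simp only [interior_Ico, Set.mem_Ioo]
    constructor <;> linarith

lemma hm_cube {n : ℕ} {𝒟 : Set (Set (Fin n → ℝ))} (hD : IsDyadicGrid 𝒟)
    {Q : Set (Fin n → ℝ)} (hQ : Q ∈ 𝒟) :
    MeasurableSet Q ∧ volume Q ≠ 0 ∧ volume Q ≠ ⊤ ∧ ∃ K, IsCompact K ∧ Q ⊆ K := by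
  obtain ⟨k, a, rfl⟩ := hD.1 Q hQ
  have hk : (0 : ℝ) < 2 ^ k := by positivity
  refine ⟨MeasurableSet.univ_pi fun i => measurableSet_Ico, ?_, ?_, ?_⟩
  · rw [volume_pi_pi, Finset.prod_ne_zero_iff]
    intro i _
    simp [hk]
  · rw [volume_pi_pi]
    refine ENNReal.prod_ne_top fun i _ => ?_
    simp
  · exact ⟨Set.univ.pi fun i => Set.Icc (a i) (a i + 2 ^ k),
      isCompact_univ_pi fun i => isCompact_Icc, Set.pi_mono fun i _ => Set.Ico_subset_Icc_self⟩

lemma hm_layer (w A : ℝ≥0∞) :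
    ∫⁻ t in Set.Ioi (0 : ℝ), {t : ℝ | ENNReal.ofReal t < w}.indicator (fun _ => A) t = A * w := by
  have hm : MeasurableSet {t : ℝ | ENNReal.ofReal t < w} :=
    measurableSet_lt ENNReal.measurable_ofReal measurable_const
  rw [lintegral_indicator hm, setLIntegral_const, Measure.restrict_apply hm]
  congr 1
  rcases eq_or_ne w ⊤ with rfl | hw
  · simp
  · have : {t : ℝ | ENNReal.ofReal t < w} ∩ Set.Ioi 0 = Set.Ioo 0 w.toReal := by
      ext t
      simp only [Set.mem_inter_iff, Set.mem_setOf_eq, Set.mem_Ioi, Set.mem_Ioo]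
      constructor
      · rintro ⟨h, h0⟩
        exact ⟨h0, (ENNReal.ofReal_lt_iff_lt_toReal h0.le hw).1 h⟩
      · rintro ⟨h0, h⟩
        exact ⟨(ENNReal.ofReal_lt_iff_lt_toReal h0.le hw).2 h, h0⟩
    rw [this, Real.volume_Ioo, sub_zero, ENNReal.ofReal_toReal hw]

/-- The factorization of the harmonic average. -/
lemma hm_factor {α : Type*} [MeasurableSpace α] (m μ : Measure α) (s : α → ℝ≥0∞)
    (hs : AEMeasurable s m) (hμ : μ = m.withDensity s)
    (F : α → ℝ≥0∞) (hF : Measurable F) (hFt : ∀ x, F x ≠ ⊤) (Q : Set α) (hQ : MeasurableSet Q)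
    (hV0 : m Q ≠ 0) (hVt : m Q ≠ ⊤) (hμt : μ Q ≠ ⊤) :
    ∃ H : ℝ≥0∞, ((m Q)⁻¹ * ∫⁻ y in Q, (F y * (s y)⁻¹)⁻¹ ∂m)⁻¹ ≤ ((m Q)⁻¹ * μ Q)⁻¹ * H ∧
      ∀ r : ℝ≥0∞, r ≠ 0 → r < H → μ Q ≤ 2 * μ (Q ∩ {x | r < 2 * F x}) := by
  rcases eq_or_ne (μ Q) 0 with h0 | h0
  · refine ⟨⊤, ?_, fun r _ _ => ?_⟩
    · simp [h0]
    · simp [h0]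
  set I := ∫⁻ y in Q, (F y * (s y)⁻¹)⁻¹ ∂m with hI
  refine ⟨μ Q / I, ?_, ?_⟩
  · rw [ENNReal.mul_inv (by simp [hVt]) (by simp [hV0]),
      ENNReal.mul_inv (by simp [hVt]) (by simp [hV0]), inv_inv, div_eq_mul_inv]
    rw [mul_assoc, ← mul_assoc (μ Q)⁻¹, ENNReal.inv_mul_cancel h0 hμt, one_mul]
  · intro r hr0 hr
    have hrt : r ≠ ⊤ := hr.ne_top
    have hrI : r * I ≤ μ Q := by
      rcases eq_or_ne I 0 with hI0 | hI0
      · simp [hI0]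
      rcases eq_or_ne I ⊤ with hIt | hIt
      · simp [hIt] at hr
      · exact ENNReal.mul_le_of_le_div hr.le
    set S := {x | r < 2 * F x} with hS
    have hSm : MeasurableSet S := measurableSet_lt measurable_const (hF.const_mul 2)
    have hT : 2 * μ (Q \ S) ≤ r * I := by
      rw [hμ, withDensity_apply _ (hQ.diff hSm), ← lintegral_const_mul' _ _ (by simp)]
      refine le_trans ?_ (mul_le_mul_right (lintegral_mono_set (Set.diff_subset (t := S))) r)
      rw [← lintegral_const_mul' _ _ hrt]
      refine setLIntegral_mono' (hQ.diff hSm) ?_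
      rintro x ⟨-, hx⟩
      have hx : 2 * F x ≤ r := not_lt.1 hx
      rcases eq_or_ne (F x) 0 with hf | hf
      · simp [hf, hr0]
      · rw [ENNReal.mul_inv (Or.inl hf) (Or.inl (hFt x)), inv_inv, ← mul_assoc]
        refine mul_le_mul_left ?_ _
        rw [← div_eq_mul_inv]
        exact (ENNReal.le_div_iff_mul_le (Or.inl hf) (Or.inl (hFt x))).2 hx
    have hsplit := measure_inter_add_diff (μ := μ) Q hSm
    have : μ Q + μ Q ≤ 2 * μ (Q ∩ S) + μ Q := by
      calc μ Q + μ Q = 2 * μ (Q ∩ S) + 2 * μ (Q \ S) := by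
            rw [← two_mul, ← hsplit, mul_add]
        _ ≤ _ := by gcongr; exact hT.trans hrI
    exact (ENNReal.add_le_add_iff_right hμt).1 this

/-- Fixed-level estimate over a finite family. -/
lemma hm_level {n : ℕ} {𝒟 : Set (Set (Fin n → ℝ))} (hD : IsDyadicGrid 𝒟)
    (μ ν : Measure (Fin n → ℝ)) (C : ℝ≥0∞) (a : Set (Fin n → ℝ) → ℝ≥0∞)
    (T : Set (Fin n → ℝ) → (Fin n → ℝ) → ℝ≥0∞)
    (hT : ∀ R ∈ 𝒟, ∫⁻ x in R, T R x ∂ν ≤ C * μ R)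
    (haT : ∀ Q ∈ 𝒟, ∀ R ∈ 𝒟, Q ⊆ R → ∀ x ∈ Q, a Q ≤ T R x)
    (F : Finset (Set (Fin n → ℝ))) (hF : ∀ Q ∈ F, Q ∈ 𝒟)
    (S : Set (Fin n → ℝ)) (hFS : ∀ Q ∈ F, μ Q ≤ 2 * μ (Q ∩ S)) (hS : MeasurableSet S) :
    ∫⁻ x, ⨆ Q ∈ F, Q.indicator (fun _ => a Q) x ∂ν ≤ C * (2 * μ S) := by
  classical
  set G := F.filter (fun R => Maximal (· ∈ F) R) with hG
  have hGF : ∀ R ∈ G, R ∈ F := fun R hR => (Finset.mem_filter.1 hR).1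
  have hGm : ∀ R ∈ G, Maximal (· ∈ F) R := fun R hR => (Finset.mem_filter.1 hR).2
  have hex : ∀ Q ∈ F, ∃ R ∈ G, Q ⊆ R := by
    intro Q hQ
    obtain ⟨R, hQR, hR⟩ := F.exists_le_maximal hQ
    exact ⟨R, Finset.mem_filter.2 ⟨hR.prop, hR⟩, hQR⟩
  have hdisj : ∀ R ∈ G, ∀ P ∈ G, R ≠ P → Disjoint R P := by
    intro R hR P hP hne
    rw [Set.disjoint_iff_inter_eq_empty]
    rcases hD.2.1 R (hF _ (hGF R hR)) P (hF _ (hGF P hP)) with h | h | h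
    · exact h
    · exact absurd ((hGm R hR).eq_of_le (hGF P hP) (Set.inter_eq_left.1 h)) hne
    · exact absurd ((hGm P hP).eq_of_le (hGF R hR) (Set.inter_eq_right.1 h)).symm hne
  have hmeas : ∀ R ∈ G, MeasurableSet R := fun R hR => (hm_cube hD (hF _ (hGF R hR))).1
  calc ∫⁻ x, ⨆ Q ∈ F, Q.indicator (fun _ => a Q) x ∂ν
      = ∫⁻ x in ⋃ R ∈ G, R, ⨆ Q ∈ F, Q.indicator (fun _ => a Q) x ∂ν := by
        symm
        apply setLIntegral_eq_of_support_subset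
        intro x hx
        rw [Function.mem_support] at hx
        by_contra hcon
        apply hx
        simp only [ENNReal.iSup_eq_zero]
        intro Q hQ
        apply Set.indicator_of_notMem
        intro hxQ
        obtain ⟨R, hR, hQR⟩ := hex Q hQ
        exact hcon (Set.mem_biUnion hR (hQR hxQ))
    _ = ∑ R ∈ G, ∫⁻ x in R, ⨆ Q ∈ F, Q.indicator (fun _ => a Q) x ∂ν :=
        lintegral_biUnion_finset (fun R hR P hP h => hdisj R hR P hP h) hmeas _
    _ ≤ ∑ R ∈ G, ∫⁻ x in R, T R x ∂ν := by
        refine Finset.sum_le_sum fun R hR => setLIntegral_mono' (hmeas R hR) fun x hx => ?_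
        refine iSup₂_le fun Q hQ => ?_
        by_cases hxQ : x ∈ Q
        · rw [Set.indicator_of_mem hxQ]
          obtain ⟨P, hP, hQP⟩ := hex Q hQ
          have hPR : P = R := by
            by_contra hne
            exact Set.disjoint_left.1 (hdisj P hP R hR hne) (hQP hxQ) hx
          subst hPR
          exact haT Q (hF Q hQ) P (hF _ (hGF _ hP)) hQP x hxQ
        · rw [Set.indicator_of_notMem hxQ]; exact zero_le
    _ ≤ ∑ R ∈ G, C * (2 * μ (R ∩ S)) := by
        refine Finset.sum_le_sum fun R hR => (hT R (hF _ (hGF R hR))).trans ?_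
        gcongr
        exact hFS R (hGF R hR)
    _ = C * (2 * μ (⋃ R ∈ G, R ∩ S)) := by
        rw [← Finset.mul_sum, ← Finset.mul_sum, measure_biUnion_finset]
        · intro R hR P hP h
          exact (hdisj R hR P hP h).mono Set.inter_subset_left Set.inter_subset_left
        · exact fun R hR => (hmeas R hR).inter hS
    _ ≤ C * (2 * μ S) := by
        gcongr
        exact Set.iUnion₂_subset fun R _ => Set.inter_subset_right

lemma hm_eq_iSup {n : ℕ} (𝒟 : Set (Set (Fin n → ℝ))) (g : (Fin n → ℝ) → ℝ≥0∞)
    (x : Fin n → ℝ) :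
    harmMax 𝒟 g x = ⨆ B ∈ 𝒟,
      B.indicator (fun _ => ((volume B)⁻¹ * ∫⁻ y in B, (g y)⁻¹)⁻¹) x := by
  unfold harmMax
  refine iSup_congr fun B => iSup_congr fun _ => ?_
  by_cases h : x ∈ B <;> simp [h]

lemma hm_measurable {n : ℕ} {𝒟 : Set (Set (Fin n → ℝ))} (hD : IsDyadicGrid 𝒟)
    (g : (Fin n → ℝ) → ℝ≥0∞) : Measurable (harmMax 𝒟 g) := by
  rw [funext (hm_eq_iSup 𝒟 g)]
  exact Measurable.biSup 𝒟 (hm_grid_countable hD)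
    fun B hB => measurable_const.indicator (hm_cube hD hB).1

/-- Finite-family estimate. -/
lemma hm_finite {n : ℕ} {𝒟 : Set (Set (Fin n → ℝ))} (hD : IsDyadicGrid 𝒟)
    (μ ν : Measure (Fin n → ℝ)) [SFinite ν] (C : ℝ≥0∞) (p : ℝ) (hp : 0 < p)
    (a m H : Set (Fin n → ℝ) → ℝ≥0∞)
    (T : Set (Fin n → ℝ) → (Fin n → ℝ) → ℝ≥0∞)
    (hT : ∀ R ∈ 𝒟, ∫⁻ x in R, T R x ∂ν ≤ C * μ R)
    (haT : ∀ Q ∈ 𝒟, ∀ R ∈ 𝒟, Q ⊆ R → ∀ x ∈ Q, a Q ^ p ≤ T R x)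
    (f : (Fin n → ℝ) → ℝ) (hf : Measurable f)
    (hm : ∀ Q ∈ 𝒟, m Q ≤ a Q * H Q)
    (hH : ∀ Q ∈ 𝒟, ∀ r : ℝ≥0∞, r ≠ 0 → r < H Q →
      μ Q ≤ 2 * μ (Q ∩ {x | r < 2 * ENNReal.ofReal |f x|}))
    (F : Finset (Set (Fin n → ℝ))) (hF : ∀ Q ∈ F, Q ∈ 𝒟) :
    ∫⁻ x, (⨆ Q ∈ F, Q.indicator (fun _ => m Q) x) ^ p ∂ν ≤
      C * (2 * ∫⁻ x, ENNReal.ofReal ((2 * |f x|) ^ p) ∂μ) := by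
  classical
  let Φ : (Fin n → ℝ) → ℝ → ℝ≥0∞ := fun x t =>
    ⨆ Q ∈ F, Q.indicator (fun _ => {t : ℝ | ENNReal.ofReal t < H Q ^ p}.indicator
      (fun _ => a Q ^ p) t) x
  have hΦ : Measurable (Function.uncurry Φ) := by
    refine Measurable.biSup (F : Set (Set (Fin n → ℝ))) F.countable_toSet fun Q hQ => ?_
    have h1 : MeasurableSet {z : (Fin n → ℝ) × ℝ | ENNReal.ofReal z.2 < H Q ^ p} :=
      measurableSet_lt (ENNReal.measurable_ofReal.comp measurable_snd) measurable_const
    have h2 : MeasurableSet {z : (Fin n → ℝ) × ℝ | z.1 ∈ Q} :=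
      measurable_fst (hm_cube hD (hF Q hQ)).1
    have : (fun z : (Fin n → ℝ) × ℝ => Q.indicator (fun _ =>
        {t : ℝ | ENNReal.ofReal t < H Q ^ p}.indicator (fun _ => a Q ^ p) z.2) z.1) =
        {z : (Fin n → ℝ) × ℝ | z.1 ∈ Q}.indicator
          ({z : (Fin n → ℝ) × ℝ | ENNReal.ofReal z.2 < H Q ^ p}.indicator
            fun _ => a Q ^ p) := by
      funext z
      simp only [Set.indicator, Set.mem_setOf_eq]
    change Measurable (fun z : (Fin n → ℝ) × ℝ => Q.indicator (fun _ =>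
        {t : ℝ | ENNReal.ofReal t < H Q ^ p}.indicator (fun _ => a Q ^ p) z.2) z.1)
    rw [this]
    exact (measurable_const.indicator h1).indicator h2
  calc ∫⁻ x, (⨆ Q ∈ F, Q.indicator (fun _ => m Q) x) ^ p ∂ν
      ≤ ∫⁻ x, (∫⁻ t in Set.Ioi (0 : ℝ), Φ x t) ∂ν := by
        refine lintegral_mono fun x => ?_
        rw [← ENNReal.le_rpow_inv_iff hp]
        refine iSup₂_le fun Q hQ => ?_
        by_cases hx : x ∈ Q
        · rw [Set.indicator_of_mem hx, ENNReal.le_rpow_inv_iff hp]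
          calc m Q ^ p ≤ (a Q * H Q) ^ p := ENNReal.rpow_le_rpow (hm Q (hF Q hQ)) hp.le
            _ = a Q ^ p * H Q ^ p := ENNReal.mul_rpow_of_nonneg _ _ hp.le
            _ = _ := (hm_layer _ _).symm
            _ ≤ _ := by
              refine lintegral_mono fun t => ?_
              refine le_iSup₂_of_le Q hQ ?_
              rw [Set.indicator_of_mem hx]
        · rw [Set.indicator_of_notMem hx]; exact zero_le
    _ = ∫⁻ t in Set.Ioi (0 : ℝ), (∫⁻ x, Φ x t ∂ν) := lintegral_lintegral_swap hΦ.aemeasurable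
    _ ≤ ∫⁻ t in Set.Ioi (0 : ℝ), C * (2 * μ {x | t < (2 * |f x|) ^ p}) := by
        refine setLIntegral_mono' measurableSet_Ioi fun t ht => ?_
        have ht : 0 < t := ht
        have hSm : MeasurableSet {x | t < (2 * |f x|) ^ p} :=
          measurableSet_lt measurable_const (by fun_prop)
        refine le_trans (lintegral_mono fun x => ?_)
          (hm_level hD μ ν C (fun Q => a Q ^ p) T hT haT
          (F.filter fun Q => ENNReal.ofReal t < H Q ^ p)
          (fun Q hQ => hF Q (Finset.mem_filter.1 hQ).1) _ ?_ hSm)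
        · refine iSup₂_le fun Q hQ => ?_
          by_cases hw : ENNReal.ofReal t < H Q ^ p
          · refine le_iSup₂_of_le Q (Finset.mem_filter.2 ⟨hQ, hw⟩) ?_
            simp [Set.indicator, hw]
          · simp [Set.indicator, hw]
        · intro Q hQ
          obtain ⟨hQ, hw⟩ := Finset.mem_filter.1 hQ
          have hr : ENNReal.ofReal t ^ p⁻¹ < H Q := (ENNReal.rpow_inv_lt_iff hp).2 hw
          have := hH Q (hF Q hQ) _ (by
            rw [Ne, ENNReal.rpow_eq_zero_iff]
            simp [ht, hp, hp.le, inv_nonneg.2 hp.le, not_lt.2]) hr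
          convert this using 4
          ext x
          simp only [Set.mem_setOf_eq]
          rw [ENNReal.rpow_inv_lt_iff hp]
          have e : 2 * ENNReal.ofReal |f x| = ENNReal.ofReal (2 * |f x|) := by
            rw [ENNReal.ofReal_mul (by norm_num)]; simp
          rw [e, ENNReal.ofReal_rpow_of_nonneg (by positivity) hp.le,
            ENNReal.ofReal_lt_ofReal_iff_of_nonneg ht.le]
    _ = C * (2 * ∫⁻ t in Set.Ioi (0 : ℝ), μ {x | t < (2 * |f x|) ^ p}) := by
        have hanti : Antitone fun t : ℝ => μ {x | t < (2 * |f x|) ^ p} :=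
          fun s t hst => measure_mono fun x hx => lt_of_le_of_lt hst hx
        rw [lintegral_const_mul _ (hanti.measurable.const_mul 2),
          lintegral_const_mul _ hanti.measurable]
    _ = _ := by
        rw [lintegral_eq_lintegral_meas_lt μ (f := fun x => (2 * |f x|) ^ p)]
        · exact Eventually.of_forall fun x => by positivity
        · exact Measurable.aemeasurable (by fun_prop)

/-- Dyadic testing implies the strong-type two-weight inequality for the
harmonic maximal operator: if
`∫_Q (M^𝒟₋₁(1_Q σ⁻¹))^p u ≤ C ∫_Q σ` for all dyadic cubes `Q`, then
`∫ (M^𝒟₋₁(f σ⁻¹))^p u ≤ C' ∫ |f|^p σ` for all `f ∈ L^p(σ)`. -/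
theorem dyadic_testing_implies_strong_type (n : ℕ) (𝒟 : Set (Set (Fin n → ℝ)))
    (hD : IsDyadicGrid 𝒟) (p : ℝ) (hp : 0 < p)
    (u σ : (Fin n → ℝ) → ℝ) (hu0 : 0 ≤ u) (hσ0 : 0 ≤ σ)
    (hu : LocallyIntegrable u volume) (hσ : LocallyIntegrable σ volume)
    (C : ℝ≥0∞) (hC : C ≠ ⊤)
    (htest : ∀ Q ∈ 𝒟,
      ∫⁻ x in Q,
          (harmMax 𝒟 (Q.indicator fun y => (ENNReal.ofReal (σ y))⁻¹) x) ^ p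
            * ENNReal.ofReal (u x)
        ≤ C * ∫⁻ y in Q, ENNReal.ofReal (σ y)) :
    ∃ C' : ℝ≥0∞, C' ≠ ⊤ ∧ ∀ f : (Fin n → ℝ) → ℝ, Measurable f →
      (∫⁻ x, ENNReal.ofReal |f x| ^ p * ENNReal.ofReal (σ x)) < ⊤ →
      ∫⁻ x,
          (harmMax 𝒟
              (fun y => ENNReal.ofReal |f y| * (ENNReal.ofReal (σ y))⁻¹) x) ^ p
            * ENNReal.ofReal (u x)
        ≤ C' * ∫⁻ x, ENNReal.ofReal |f x| ^ p * ENNReal.ofReal (σ x) := by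
  set U : (Fin n → ℝ) → ℝ≥0∞ := fun x => ENNReal.ofReal (u x) with hU
  set s : (Fin n → ℝ) → ℝ≥0∞ := fun x => ENNReal.ofReal (σ x) with hs
  have hUm : AEMeasurable U volume := hu.aestronglyMeasurable.aemeasurable.ennreal_ofReal
  have hsm : AEMeasurable s volume := hσ.aestronglyMeasurable.aemeasurable.ennreal_ofReal
  set ν := (volume : Measure (Fin n → ℝ)).withDensity U with hν
  set μ := (volume : Measure (Fin n → ℝ)).withDensity s with hμ
  have hcount := hm_grid_countable hD
  have hμQ : ∀ Q ∈ 𝒟, μ Q = ∫⁻ y in Q, s y :=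
    fun Q hQ => withDensity_apply _ (hm_cube hD hQ).1
  have hμfin : ∀ Q ∈ 𝒟, μ Q ≠ ⊤ := by
    intro Q hQ
    obtain ⟨-, -, -, K, hK, hQK⟩ := hm_cube hD hQ
    rw [hμQ Q hQ]
    have h1 : IntegrableOn σ Q volume := (hσ.integrableOn_isCompact hK).mono_set hQK
    exact (Integrable.lintegral_lt_top h1).ne
  refine ⟨C * (2 * ENNReal.ofReal (2 ^ p)), by finiteness, fun f hf _ => ?_⟩
  set g : (Fin n → ℝ) → ℝ≥0∞ := fun y => ENNReal.ofReal |f y| * (s y)⁻¹ with hg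
  have hfac : ∀ Q ∈ 𝒟, ∃ H : ℝ≥0∞,
      ((volume Q)⁻¹ * ∫⁻ y in Q, (g y)⁻¹)⁻¹ ≤ ((volume Q)⁻¹ * μ Q)⁻¹ * H ∧
      ∀ r : ℝ≥0∞, r ≠ 0 → r < H →
        μ Q ≤ 2 * μ (Q ∩ {x | r < 2 * ENNReal.ofReal |f x|}) := by
    intro Q hQ
    obtain ⟨h1, h2, h3, -⟩ := hm_cube hD hQ
    exact hm_factor volume μ s hsm hμ (fun x => ENNReal.ofReal |f x|) (by fun_prop)
      (fun x => ENNReal.ofReal_ne_top) Q h1 h2 h3 (hμfin Q hQ)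
  choose! H hH1 hH2 using hfac
  set T : Set (Fin n → ℝ) → (Fin n → ℝ) → ℝ≥0∞ :=
    fun R x => (harmMax 𝒟 (R.indicator fun y => (s y)⁻¹) x) ^ p with hTdef
  have hT : ∀ R ∈ 𝒟, ∫⁻ x in R, T R x ∂ν ≤ C * μ R := by
    intro R hR
    have hRm := (hm_cube hD hR).1
    rw [hμQ R hR]
    refine le_trans (le_of_eq ?_) (htest R hR)
    rw [hν, restrict_withDensity hRm,
      lintegral_withDensity_eq_lintegral_mul₀ hUm.restrict
        ((hm_measurable hD _).pow_const p).aemeasurable]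
    refine lintegral_congr fun x => ?_
    simp only [Pi.mul_apply]
    rw [mul_comm]
  have haT : ∀ Q ∈ 𝒟, ∀ R ∈ 𝒟, Q ⊆ R → ∀ x ∈ Q,
      (((volume Q)⁻¹ * μ Q)⁻¹) ^ p ≤ T R x := by
    intro Q hQ R hR hQR x hx
    refine ENNReal.rpow_le_rpow ?_ hp.le
    rw [hm_eq_iSup]
    refine le_iSup₂_of_le Q hQ ?_
    rw [Set.indicator_of_mem hx, hμQ Q hQ]
    refine le_of_eq ?_
    congr 2
    refine setLIntegral_congr_fun (hm_cube hD hQ).1 fun y hy => ?_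
    simp only [Set.indicator_of_mem (hQR hy), inv_inv]
  have hne : 𝒟.Nonempty := by
    obtain ⟨Q, hQ, -⟩ := hD.2.2 0 0
    exact ⟨Q, hQ⟩
  obtain ⟨e, he⟩ := hcount.exists_eq_range hne
  have he𝒟 : ∀ i, e i ∈ 𝒟 := fun i => he ▸ Set.mem_range_self i
  classical
  let m : Set (Fin n → ℝ) → ℝ≥0∞ := fun Q => ((volume Q)⁻¹ * ∫⁻ y in Q, (g y)⁻¹)⁻¹
  let F : ℕ → Finset (Set (Fin n → ℝ)) := fun N => (Finset.range N).image e
  have hF : ∀ N, ∀ Q ∈ F N, Q ∈ 𝒟 := by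
    intro N Q hQ
    obtain ⟨i, -, rfl⟩ := Finset.mem_image.1 hQ
    exact he𝒟 i
  have hFmono : Monotone F := fun N M h => Finset.image_subset_image (Finset.range_mono h)
  let h : ℕ → (Fin n → ℝ) → ℝ≥0∞ := fun N x => ⨆ Q ∈ F N, Q.indicator (fun _ => m Q) x
  have hle : ∀ x, harmMax 𝒟 g x ≤ ⨆ N, h N x := by
    intro x
    rw [hm_eq_iSup]
    refine iSup₂_le fun Q hQ => ?_
    rw [he] at hQ
    obtain ⟨i, rfl⟩ := hQ
    refine le_iSup_of_le (i + 1) ?_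
    exact le_iSup₂_of_le (f := fun Q (_ : Q ∈ F (i + 1)) => Q.indicator (fun _ => m Q) x)
      (e i) (Finset.mem_image.2 ⟨i, by simp, rfl⟩) le_rfl
  have hhm : ∀ N, Measurable (h N) := fun N =>
    Measurable.biSup (F N : Set (Set (Fin n → ℝ))) (F N).countable_toSet
      fun Q hQ => measurable_const.indicator (hm_cube hD (hF N Q hQ)).1
  have hhmono : Monotone h := fun N M hNM x =>
    iSup₂_le fun Q hQ =>
      le_iSup₂_of_le (f := fun Q (_ : Q ∈ F M) => Q.indicator (fun _ => m Q) x)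
        Q (hFmono hNM hQ) le_rfl
  have hfinal : ∫⁻ x, ENNReal.ofReal ((2 * |f x|) ^ p) ∂μ =
      ENNReal.ofReal (2 ^ p) * ∫⁻ x, ENNReal.ofReal |f x| ^ p * s x := by
    rw [hμ, lintegral_withDensity_eq_lintegral_mul₀ hsm
      (Measurable.aemeasurable (by fun_prop)), ← lintegral_const_mul' _ _ ENNReal.ofReal_ne_top]
    refine lintegral_congr fun x => ?_
    simp only [Pi.mul_apply]
    rw [Real.mul_rpow (by norm_num) (abs_nonneg _), ENNReal.ofReal_mul (by positivity),
      ENNReal.ofReal_rpow_of_nonneg (abs_nonneg _) hp.le]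
    ring
  calc ∫⁻ x, (harmMax 𝒟 g x) ^ p * U x
      = ∫⁻ x, (harmMax 𝒟 g x) ^ p ∂ν := by
        rw [hν, lintegral_withDensity_eq_lintegral_mul₀ hUm
          ((hm_measurable hD _).pow_const p).aemeasurable]
        refine lintegral_congr fun x => ?_
        simp only [Pi.mul_apply]
        rw [mul_comm]
    _ ≤ ∫⁻ x, ⨆ N, (h N x) ^ p ∂ν := by
        refine lintegral_mono fun x => ?_
        refine (ENNReal.rpow_le_rpow (hle x) hp.le).trans (le_of_eq ?_)
        exact (ENNReal.orderIsoRpow p hp).map_iSup _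
    _ = ⨆ N, ∫⁻ x, (h N x) ^ p ∂ν :=
        lintegral_iSup (fun N => (hhm N).pow_const p)
          fun N M hNM x => ENNReal.rpow_le_rpow (hhmono hNM x) hp.le
    _ ≤ C * (2 * ∫⁻ x, ENNReal.ofReal ((2 * |f x|) ^ p) ∂μ) :=
        iSup_le fun N => hm_finite hD μ ν C p hp (fun Q => ((volume Q)⁻¹ * μ Q)⁻¹) m H T hT haT
          f hf hH1 hH2 (F N) (hF N)
    _ = _ := by rw [hfinal]; ring
end

section
/- Boundedness of the weighted dyadic limiting geometric maximal operator: for any weight σ and any 0 < p < ∞, the operator M^𝖣_{0^+,σ} f = lim_{r→0^+} M^𝖣_{r,σ} f is bounded on L^p(σ) with operator norm at most e^{1/p}. -/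
open MeasureTheory Set ENNReal Filter

lemma aux_weak {α ι : Type*} [MeasurableSpace α] (μ ν : Measure α) (A : ι → Set α)
    (hm : ∀ i, MeasurableSet (A i))
    (hn : ∀ i j, A i ∩ A j = ∅ ∨ A i ∩ A j = A i ∨ A i ∩ A j = A j) (t : ℝ≥0∞)
    (S : Finset ι) (h : ∀ i ∈ S, t * μ (A i) ≤ ν (A i)) :
    t * μ (⋃ i ∈ S, A i) ≤ ν (⋃ i ∈ S, A i) := by
  classical
  suffices H : ∀ S' ⊆ S, t * μ (⋃ i ∈ S', A i) ≤ ν (⋃ i ∈ S', A i) from H S subset_rfl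
  induction S using Finset.induction_on with
  | empty => intro S' hS'; simp [Finset.subset_empty.mp hS']
  | insert q S hq ih =>
    have ih := ih (fun i hi => h i (Finset.mem_insert_of_mem hi))
    intro S' hS'
    by_cases hqS : q ∈ S'
    swap
    · apply ih
      intro i hi
      rcases Finset.mem_insert.mp (hS' hi) with rfl | h'
      · exact absurd hi hqS
      · exact h'
    by_cases hP : ∃ P ∈ S'.erase q, A q ⊆ A P
    · obtain ⟨P, hP, hqP⟩ := hP
      have e : (⋃ i ∈ S', A i) = ⋃ i ∈ S'.erase q, A i := by
        ext x
        simp only [mem_iUnion, exists_prop]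
        constructor
        · rintro ⟨i, hi, hx⟩
          by_cases hiq : i = q
          · subst hiq; exact ⟨P, hP, hqP hx⟩
          · exact ⟨i, Finset.mem_erase.mpr ⟨hiq, hi⟩, hx⟩
        · rintro ⟨i, hi, hx⟩
          exact ⟨i, Finset.mem_of_mem_erase hi, hx⟩
      rw [e]
      apply ih
      intro i hi
      rcases Finset.mem_insert.mp (hS' (Finset.mem_of_mem_erase hi)) with rfl | h'
      · simp at hi
      · exact h'
    · push Not at hP
      set T := (S'.erase q).filter (fun i => A q ∩ A i = ∅) with hT
      have e : (⋃ i ∈ S', A i) = A q ∪ ⋃ i ∈ T, A i := by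
        ext x
        simp only [mem_iUnion, exists_prop, mem_union]
        constructor
        · rintro ⟨i, hi, hx⟩
          by_cases hiq : i = q
          · subst hiq; exact Or.inl hx
          · have hi' : i ∈ S'.erase q := Finset.mem_erase.mpr ⟨hiq, hi⟩
            rcases hn q i with h1 | h1 | h1
            · exact Or.inr ⟨i, Finset.mem_filter.mpr ⟨hi', h1⟩, hx⟩
            · exact absurd (inter_eq_left.mp h1) (hP i hi')
            · exact Or.inl (inter_eq_right.mp h1 hx)
        · rintro (hx | ⟨i, hi, hx⟩)
          · exact ⟨q, hqS, hx⟩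
          · exact ⟨i, Finset.mem_of_mem_erase (Finset.mem_filter.mp hi).1, hx⟩
      have hd : Disjoint (A q) (⋃ i ∈ T, A i) := by
        rw [disjoint_iUnion₂_right]
        intro i hi
        exact disjoint_iff_inter_eq_empty.mpr (Finset.mem_filter.mp hi).2
      have hmT : MeasurableSet (⋃ i ∈ T, A i) := T.measurableSet_biUnion (fun i _ => hm i)
      rw [e, measure_union hd hmT, measure_union hd hmT, mul_add]
      gcongr
      · exact h q (Finset.mem_insert_self _ _)
      · apply ih
        intro i hi
        have hi := (Finset.mem_filter.mp hi).1
        rcases Finset.mem_insert.mp (hS' (Finset.mem_of_mem_erase hi)) with rfl | h'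
        · simp at hi
        · exact h'

lemma aux_countable {n : ℕ} (D : Set (Set (Fin n → ℝ)))
    (h1 : ∀ Q ∈ D, ∃ (k : ℤ) (a : Fin n → ℝ),
      Q = Set.univ.pi fun i => Set.Ico (a i) (a i + (2 : ℝ) ^ k))
    (h2 : ∀ Q ∈ D, ∀ P ∈ D, Q ∩ P = ∅ ∨ Q ∩ P = Q ∨ Q ∩ P = P) : D.Countable := by
  have key : ∀ (k : ℤ) (a b : Fin n → ℝ),
      (Set.univ.pi fun i => Set.Ico (a i) (a i + (2 : ℝ) ^ k)) ⊆
      (Set.univ.pi fun i => Set.Ico (b i) (b i + (2 : ℝ) ^ k)) → a = b := by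
    intro k a b h
    have hk : (0:ℝ) < 2 ^ k := by positivity
    rw [Set.univ_pi_subset_univ_pi_iff] at h
    rcases h with h | ⟨i, h⟩
    · funext i
      have := (Set.Ico_subset_Ico_iff (by linarith)).mp (h i)
      linarith [this.1, this.2]
    · have h' := Set.Ico_eq_empty_iff.mp h
      exact absurd (by linarith) h'
  have : D = ⋃ k : ℤ, {Q ∈ D | ∃ a : Fin n → ℝ,
      Q = Set.univ.pi fun i => Set.Ico (a i) (a i + (2 : ℝ) ^ k)} := by
    ext Q
    simp only [mem_iUnion, mem_ofPred_eq]
    exact ⟨fun h => (h1 Q h).imp fun k hk => ⟨h, hk⟩, fun ⟨_, h, _⟩ => h⟩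
  rw [this]
  refine countable_iUnion fun k => ?_
  refine Set.PairwiseDisjoint.countable_of_nonempty_interior (s := id) ?_ ?_
  · rintro Q ⟨hQ, a, ha⟩ P ⟨hP, b, hb⟩ hne
    simp only [Function.onFun, id]
    rcases h2 Q hQ P hP with h | h | h
    · exact disjoint_iff_inter_eq_empty.mpr h
    · exfalso; apply hne
      have := inter_eq_left.mp h
      rw [ha, hb] at this
      rw [ha, hb, key k a b this]
    · exfalso; apply hne
      have := inter_eq_right.mp h
      rw [ha, hb] at this
      rw [ha, hb, key k b a this]
  · rintro Q ⟨hQ, a, rfl⟩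
    have hk : (0:ℝ) < 2 ^ k := by positivity
    simp only [id]
    rw [interior_pi_set finite_univ, univ_pi_nonempty_iff]
    intro i
    rw [interior_Ico]
    simpa using hk

lemma aux_finite {α ι : Type*} [MeasurableSpace α] (μ : Measure α) (A : ι → Set α)
    (hm : ∀ i, MeasurableSet (A i))
    (hn : ∀ i j, A i ∩ A j = ∅ ∨ A i ∩ A j = A i ∨ A i ∩ A j = A j)
    (hfin : ∀ i, μ (A i) ≠ ⊤) (g : α → ℝ≥0∞) (hg : Measurable g) (q : ℝ) (hq : 1 < q)
    (hgq : ∫⁻ x, g x ^ q ∂μ ≠ ⊤) (S : Finset ι) :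
    ∫⁻ x, (⨆ i ∈ S, (A i).indicator (fun _ => (μ (A i))⁻¹ * ∫⁻ y in A i, g y ∂μ) x) ^ q ∂μ
      ≤ ENNReal.ofReal (q / (q - 1)) ^ q * ∫⁻ x, g x ^ q ∂μ := by
  set c : ι → ℝ≥0∞ := fun i => (μ (A i))⁻¹ * ∫⁻ y in A i, g y ∂μ with hc
  set M : α → ℝ≥0∞ := fun x => ⨆ i ∈ S, (A i).indicator (fun _ => c i) x with hM
  have hq0 : 0 < q := by linarith
  have hMm : Measurable M :=
    Measurable.biSup (S : Set ι) S.countable_toSet fun i _ => measurable_const.indicator (hm i)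
  have hint : ∀ i, ∫⁻ y in A i, g y ∂μ ≠ ⊤ := by
    intro i
    have h1 : ∫⁻ y in A i, g y ∂μ ≤ ∫⁻ y in A i, (1 + g y ^ q) ∂μ := by
      apply lintegral_mono
      intro y
      show g y ≤ 1 + g y ^ q
      rcases le_total (g y) 1 with h | h
      · exact h.trans le_self_add
      · calc g y = g y ^ (1:ℝ) := by simp
          _ ≤ g y ^ q := ENNReal.rpow_le_rpow_of_exponent_le h hq.le
          _ ≤ _ := le_add_self
    rw [lintegral_add_left measurable_const] at h1
    refine ne_top_of_le_ne_top ?_ h1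
    refine ENNReal.add_ne_top.mpr ⟨by simpa using hfin i, ?_⟩
    exact ne_top_of_le_ne_top hgq (setLIntegral_le_lintegral _ _)
  have hcfin : ∀ i, c i ≠ ⊤ := by
    intro i
    by_cases h0 : μ (A i) = 0
    · have : ∫⁻ y in A i, g y ∂μ = 0 := setLIntegral_measure_zero _ _ h0
      simp [hc, this]
    · exact ENNReal.mul_ne_top (ENNReal.inv_ne_top.mpr h0) (hint i)
  have hMle : ∀ x, M x ≤ ∑ i ∈ S, (A i).indicator (fun _ => c i) x := by
    intro x
    refine iSup₂_le fun i hi => ?_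
    exact Finset.single_le_sum (f := fun i => (A i).indicator (fun _ => c i) x)
      (fun _ _ => zero_le) hi
  have hMfin : ∀ x, M x ≠ ⊤ := by
    intro x
    refine ne_top_of_le_ne_top ?_ (hMle x)
    refine ENNReal.sum_ne_top.mpr fun i _ => ?_
    by_cases hx : x ∈ A i <;> simp [hx, hcfin i]
  have hMqle : ∀ x, M x ^ q ≤ ∑ i ∈ S, (A i).indicator (fun _ => c i ^ q) x := by
    intro x
    by_cases hS : S.Nonempty
    · obtain ⟨i, hi, hix⟩ := S.exists_mem_eq_sup hS (fun i => (A i).indicator (fun _ => c i) x)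
      have : M x = (A i).indicator (fun _ => c i) x := by
        rw [← hix, Finset.sup_eq_iSup]
      rw [this]
      refine le_trans ?_ (Finset.single_le_sum (f := fun i => (A i).indicator (fun _ => c i ^ q) x)
        (fun _ _ => zero_le) hi)
      by_cases hx : x ∈ A i <;> simp [hx, hq0]
    · rw [Finset.not_nonempty_iff_eq_empty] at hS
      simp [hM, hS, hq0]
  have hAfin : ∫⁻ x, M x ^ q ∂μ ≠ ⊤ := by
    refine ne_top_of_le_ne_top ?_ (lintegral_mono hMqle)
    rw [lintegral_finsetSum _ fun i _ => measurable_const.indicator (hm i)]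
    refine ENNReal.sum_ne_top.mpr fun i _ => ?_
    rw [lintegral_indicator_const (hm i)]
    exact ENNReal.mul_ne_top (ENNReal.rpow_ne_top_of_nonneg hq0.le (hcfin i)) (hfin i)
  -- weak type
  set ν := μ.withDensity g with hν
  have hweak : ∀ t : ℝ, 0 < t → ENNReal.ofReal t * μ {x | t < (M x).toReal}
      ≤ ν {x | t < (M x).toReal} := by
    intro t ht
    classical
    have e : {x | t < (M x).toReal} = ⋃ i ∈ S.filter (fun i => ENNReal.ofReal t < c i), A i := by
      ext x
      simp only [mem_ofPred_eq, mem_iUnion, Finset.mem_filter, exists_prop]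
      rw [← ENNReal.ofReal_lt_iff_lt_toReal ht.le (hMfin x)]
      simp only [hM, lt_iSup_iff, exists_prop]
      constructor
      · rintro ⟨i, hi, h⟩
        by_cases hx : x ∈ A i
        · rw [indicator_of_mem hx] at h
          exact ⟨i, ⟨hi, h⟩, hx⟩
        · rw [indicator_of_notMem hx] at h
          exact absurd h _root_.not_lt_zero
      · rintro ⟨i, ⟨hi, h⟩, hx⟩
        exact ⟨i, hi, by rwa [indicator_of_mem hx]⟩
    rw [e]
    apply aux_weak μ ν A hm hn
    intro i hi
    have hi := (Finset.mem_filter.mp hi).2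
    rw [hν, withDensity_apply _ (hm i)]
    by_cases h0 : μ (A i) = 0
    · simp [h0]
    · calc ENNReal.ofReal t * μ (A i) ≤ c i * μ (A i) := by gcongr
        _ = ∫⁻ y in A i, g y ∂μ := by
          simp only [hc]
          rw [mul_comm, ← mul_assoc, ENNReal.mul_inv_cancel h0 (hfin i), one_mul]
  have hconv : ∀ (s : ℝ), 0 < s → ∀ x, ENNReal.ofReal ((M x).toReal ^ s) = M x ^ s := by
    intro s hs x
    rw [← ENNReal.ofReal_rpow_of_nonneg ENNReal.toReal_nonneg hs.le,
      ENNReal.ofReal_toReal (hMfin x)]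
  have L1 := lintegral_rpow_eq_lintegral_meas_lt_mul μ (f := fun x => (M x).toReal)
    (Eventually.of_forall fun x => ENNReal.toReal_nonneg) hMm.ennreal_toReal.aemeasurable hq0
  have L2 := lintegral_rpow_eq_lintegral_meas_lt_mul ν (f := fun x => (M x).toReal)
    (Eventually.of_forall fun x => ENNReal.toReal_nonneg) hMm.ennreal_toReal.aemeasurable
    (p := q - 1) (by linarith)
  simp only [hconv q hq0] at L1
  simp only [hconv (q - 1) (by linarith)] at L2
  have step1 : ∫⁻ x, M x ^ q ∂μ ≤ ENNReal.ofReal (q / (q - 1)) * ∫⁻ x, M x ^ (q - 1) ∂ν := by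
    rw [L1, L2, ← mul_assoc, ← ENNReal.ofReal_mul (by apply div_nonneg <;> linarith),
      div_mul_cancel₀ _ (by linarith)]
    gcongr ENNReal.ofReal q * ?_
    apply setLIntegral_mono' measurableSet_Ioi
    intro t ht
    have ht : 0 < t := ht
    calc μ {x | t < (M x).toReal} * ENNReal.ofReal (t ^ (q - 1))
        = (ENNReal.ofReal t * μ {x | t < (M x).toReal}) * ENNReal.ofReal (t ^ (q - 1 - 1)) := by
          rw [mul_comm (ENNReal.ofReal t), mul_assoc, ← ENNReal.ofReal_mul ht.le]
          congr 2
          rw [Real.rpow_sub_one ht.ne' (q - 1)]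
          field_simp
      _ ≤ _ := by gcongr; exact hweak t ht
  have hconj : q.HolderConjugate (q / (q - 1)) := Real.HolderConjugate.conjExponent hq
  have step2 : ∫⁻ x, M x ^ (q - 1) ∂ν ≤
      (∫⁻ x, g x ^ q ∂μ) ^ (1 / q) * (∫⁻ x, M x ^ q ∂μ) ^ ((q - 1) / q) := by
    rw [hν, lintegral_withDensity_eq_lintegral_mul _ hg (hMm.pow_const _)]
    refine (ENNReal.lintegral_mul_le_Lp_mul_Lq μ hconj hg.aemeasurable
      (hMm.pow_const _).aemeasurable).trans (le_of_eq ?_)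
    congr 2
    · refine lintegral_congr fun x => ?_
      rw [← ENNReal.rpow_mul, mul_div_cancel₀ _ (by linarith)]
    · rw [one_div_div]
  set I := ∫⁻ x, M x ^ q ∂μ with hI
  set G := ∫⁻ x, g x ^ q ∂μ with hG
  by_cases hI0 : I = 0
  · rw [hI0]; exact zero_le
  have step3 : I ^ (1 / q) * I ^ ((q - 1) / q)
      ≤ (ENNReal.ofReal (q / (q - 1)) * G ^ (1 / q)) * I ^ ((q - 1) / q) := by
    rw [← ENNReal.rpow_add _ _ hI0 hAfin]
    have : 1 / q + (q - 1) / q = 1 := by field_simp; ring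
    rw [this, ENNReal.rpow_one, mul_assoc]
    exact step1.trans (by gcongr)
  have step4 : I ^ (1 / q) ≤ ENNReal.ofReal (q / (q - 1)) * G ^ (1 / q) := by
    refine (ENNReal.mul_le_mul_iff_left ?_ ?_).mp step3
    · simp [hI0, hAfin]
    · exact ENNReal.rpow_ne_top_of_nonneg (div_nonneg (by linarith) hq0.le) hAfin
  have := ENNReal.rpow_le_rpow step4 hq0.le
  rwa [ENNReal.mul_rpow_of_nonneg _ _ hq0.le, ← ENNReal.rpow_mul, ← ENNReal.rpow_mul,
    one_div_mul_cancel hq0.ne', ENNReal.rpow_one, ENNReal.rpow_one] at this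

lemma aux_rpow_iSup {ι : Sort*} (f : ι → ℝ≥0∞) (q : ℝ) (hq : 0 < q) :
    (⨆ i, f i) ^ q = ⨆ i, f i ^ q := (ENNReal.orderIsoRpow q hq).map_iSup f

lemma aux_doob {α ι : Type*} [MeasurableSpace α] [Countable ι] (μ : Measure α) (A : ι → Set α)
    (hm : ∀ i, MeasurableSet (A i))
    (hn : ∀ i j, A i ∩ A j = ∅ ∨ A i ∩ A j = A i ∨ A i ∩ A j = A j)
    (hfin : ∀ i, μ (A i) ≠ ⊤) (g : α → ℝ≥0∞) (hg : Measurable g) (q : ℝ) (hq : 1 < q)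
    (hgq : ∫⁻ x, g x ^ q ∂μ ≠ ⊤) :
    ∫⁻ x, (⨆ i, (A i).indicator (fun _ => (μ (A i))⁻¹ * ∫⁻ y in A i, g y ∂μ) x) ^ q ∂μ
      ≤ ENNReal.ofReal (q / (q - 1)) ^ q * ∫⁻ x, g x ^ q ∂μ := by
  have e : ∀ x, (⨆ i, (A i).indicator (fun _ => (μ (A i))⁻¹ * ∫⁻ y in A i, g y ∂μ) x) ^ q
      = ⨆ S : Finset ι,
        (⨆ i ∈ S, (A i).indicator (fun _ => (μ (A i))⁻¹ * ∫⁻ y in A i, g y ∂μ) x) ^ q := by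
    intro x
    rw [iSup_eq_iSup_finset, aux_rpow_iSup _ q (by linarith)]
  simp only [e]
  rw [lintegral_iSup_directed]
  · exact iSup_le fun S => aux_finite μ A hm hn hfin g hg q hq hgq S
  · intro S
    exact ((Measurable.biSup (S : Set ι) S.countable_toSet fun i _ =>
      measurable_const.indicator (hm i)).pow_const q).aemeasurable
  · refine Monotone.directed_le ?_
    intro S T hST x
    refine ENNReal.rpow_le_rpow ?_ (by linarith)
    exact biSup_mono fun i hi => hST hi

lemma aux_const : Tendsto (fun k : ℕ =>
    ENNReal.ofReal (((k:ℝ) + 2) / ((k:ℝ) + 2 - 1)) ^ ((k:ℝ) + 2)) atTop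
    (nhds (ENNReal.ofReal (Real.exp 1))) := by
  have h1 : Tendsto (fun k : ℕ => (1 + 1 / ((k:ℝ) + 1)) ^ (k + 1) * (1 + 1 / ((k:ℝ) + 1))) atTop
      (nhds (Real.exp 1 * (1 + 0))) := by
    refine Tendsto.mul ?_ (tendsto_const_nhds.add tendsto_one_div_add_atTop_nhds_zero_nat)
    have := (tendsto_add_atTop_iff_nat 1).mpr (Real.tendsto_one_add_div_pow_exp 1)
    simpa using this
  rw [add_zero, mul_one] at h1
  refine (ENNReal.tendsto_ofReal h1).congr fun k => ?_
  have hk : (0:ℝ) ≤ k := Nat.cast_nonneg k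
  have hb : ((k:ℝ) + 2) / ((k:ℝ) + 2 - 1) = 1 + 1 / ((k:ℝ) + 1) := by
    have : (k:ℝ) + 2 - 1 = k + 1 := by ring
    rw [this]; field_simp; ring
  rw [hb, ENNReal.ofReal_rpow_of_nonneg (by positivity) (by positivity), ← pow_succ]
  congr 1
  rw [← Real.rpow_natCast]
  congr 1
  push_cast; ring

/-- Boundedness of the weighted dyadic limiting geometric maximal operator
`M^𝒟_{0⁺,σ} f = lim_{r→0⁺} M^𝒟_{r,σ} f` on `L^p(σ)`, with norm at most `e^{1/p}`. -/
theorem limiting_geomMax_bounded (n : ℕ) (𝒟 : Set (Set (Fin n → ℝ)))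
    (hD : IsDyadicGrid 𝒟)
    (σ : (Fin n → ℝ) → ℝ) (hσ0 : 0 ≤ σ) (hσ : LocallyIntegrable σ volume)
    (p : ℝ) (hp : 0 < p)
    (f : (Fin n → ℝ) → ℝ) (hf : Measurable f)
    (F : (Fin n → ℝ) → ℝ≥0∞)
    (hF : ∀ x, Tendsto (fun r : ℝ =>
        ⨆ (Q ∈ 𝒟) (_ : x ∈ Q),
          ((∫⁻ y in Q, ENNReal.ofReal (σ y))⁻¹
            * ∫⁻ y in Q, ENNReal.ofReal |f y| ^ r * ENNReal.ofReal (σ y)) ^ (1 / r))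
      (nhdsWithin 0 (Set.Ioi 0)) (nhds (F x))) :
    (∫⁻ x, F x ^ p * ENNReal.ofReal (σ x)) ^ (1 / p)
      ≤ ENNReal.ofReal (Real.exp (1 / p))
        * (∫⁻ x, ENNReal.ofReal |f x| ^ p * ENNReal.ofReal (σ x)) ^ (1 / p) := by
  classical
  obtain ⟨hD1, hD2, -⟩ := hD
  have hcount : Countable 𝒟 := (aux_countable 𝒟 hD1 hD2).to_subtype
  have hσm : AEMeasurable (fun x => ENNReal.ofReal (σ x)) volume :=
    hσ.aestronglyMeasurable.aemeasurable.ennreal_ofReal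
  set μ : Measure (Fin n → ℝ) := volume.withDensity (fun x => ENNReal.ofReal (σ x)) with hμ
  have hQm : ∀ Q : 𝒟, MeasurableSet (Q : Set (Fin n → ℝ)) := by
    rintro ⟨Q, hQ⟩
    obtain ⟨k, a, rfl⟩ := hD1 Q hQ
    exact MeasurableSet.univ_pi fun i => measurableSet_Ico
  have hμQ : ∀ Q : 𝒟, μ Q = ∫⁻ y in (Q : Set (Fin n → ℝ)), ENNReal.ofReal (σ y) :=
    fun Q => withDensity_apply _ (hQm Q)
  have hfin : ∀ Q : 𝒟, μ Q ≠ ⊤ := by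
    intro Q
    rw [hμQ]
    obtain ⟨Q, hQ⟩ := Q
    obtain ⟨k, a, rfl⟩ := hD1 Q hQ
    have hK : IsCompact (Set.univ.pi fun i => Set.Icc (a i) (a i + (2 : ℝ) ^ k)) :=
      isCompact_univ_pi fun i => isCompact_Icc
    have := (hσ.integrableOn_isCompact hK).mono_set
      (Set.pi_mono fun i _ => (Set.Ico_subset_Icc_self :
        Set.Ico (a i) (a i + (2 : ℝ) ^ k) ⊆ Set.Icc (a i) (a i + (2 : ℝ) ^ k)))
    exact this.setLIntegral_lt_top.ne
  set u : (Fin n → ℝ) → ℝ≥0∞ := fun x => ENNReal.ofReal |f x| with hu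
  have hum : Measurable u := (measurable_norm.comp hf).ennreal_ofReal
  have hp0 : (0:ℝ) ≤ 1 / p := by positivity
  have hLf : ∫⁻ x, u x ^ p * ENNReal.ofReal (σ x) = ∫⁻ x, u x ^ p ∂μ := by
    rw [hμ, lintegral_withDensity_eq_lintegral_mul₀ hσm (hum.pow_const p).aemeasurable]
    exact lintegral_congr fun x => mul_comm _ _
  change _ ≤ _ * (∫⁻ x, u x ^ p * ENNReal.ofReal (σ x)) ^ (1 / p)
  rw [hLf]
  by_cases htop : ∫⁻ x, u x ^ p ∂μ = ⊤
  · rw [htop, ENNReal.top_rpow_of_pos (by positivity), ENNReal.mul_top]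
    · exact le_top
    · simpa using Real.exp_pos _
  -- the maximal functions along `r = p / (k + 2)`
  set N : ℕ → (Fin n → ℝ) → ℝ≥0∞ := fun k x => (⨆ Q : 𝒟, (Q : Set (Fin n → ℝ)).indicator
    (fun _ => (μ Q)⁻¹ * ∫⁻ y in (Q : Set (Fin n → ℝ)), u y ^ (p / ((k:ℝ) + 2)) ∂μ) x)
      ^ ((k:ℝ) + 2) with hN
  have hNm : ∀ k, Measurable (N k) := fun k =>
    (Measurable.iSup fun Q => measurable_const.indicator (hQm Q)).pow_const _
  have hNint : ∀ k, ∫⁻ x, N k x ∂μ ≤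
      ENNReal.ofReal (((k:ℝ) + 2) / ((k:ℝ) + 2 - 1)) ^ ((k:ℝ) + 2) * ∫⁻ x, u x ^ p ∂μ := by
    intro k
    have hk : (0:ℝ) ≤ k := Nat.cast_nonneg k
    have e : ∀ x, (u x ^ (p / ((k:ℝ) + 2))) ^ ((k:ℝ) + 2) = u x ^ p := by
      intro x
      rw [← ENNReal.rpow_mul, div_mul_cancel₀ _ (by positivity)]
    have := aux_doob μ (fun Q : 𝒟 => (Q : Set (Fin n → ℝ))) hQm
      (fun Q P => hD2 Q Q.2 P P.2) hfin (fun x => u x ^ (p / ((k:ℝ) + 2)))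
      (hum.pow_const _) ((k:ℝ) + 2) (by linarith) (by simpa only [e] using htop)
    simpa only [e] using this
  have hr : Tendsto (fun k : ℕ => p / ((k:ℝ) + 2)) atTop (nhdsWithin 0 (Set.Ioi 0)) := by
    rw [tendsto_nhdsWithin_iff]
    refine ⟨?_, Eventually.of_forall fun k => ?_⟩
    · refine Tendsto.const_div_atTop ?_ p
      exact tendsto_atTop_add_const_right _ _ tendsto_natCast_atTop_atTop
    · show 0 < p / ((k:ℝ) + 2)
      positivity
  have hlim : ∀ x, Tendsto (fun k => N k x) atTop (nhds (F x ^ p)) := by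
    intro x
    refine ((ENNReal.continuous_rpow_const (y := p)).continuousAt.tendsto.comp
      ((hF x).comp hr)).congr fun k => ?_
    have hk : (0:ℝ) < (k:ℝ) + 2 := by positivity
    simp only [Function.comp, hN]
    rw [aux_rpow_iSup _ _ hk, iSup_subtype, aux_rpow_iSup _ _ hp]
    refine iSup_congr fun Q => ?_
    rw [aux_rpow_iSup _ _ hp]
    refine iSup_congr fun hQ => ?_
    rw [aux_rpow_iSup _ _ hp]
    have hQ' := hQm ⟨Q, hQ⟩
    have e1 : μ Q = ∫⁻ y in Q, ENNReal.ofReal (σ y) := hμQ ⟨Q, hQ⟩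
    have e2 : ∫⁻ y in Q, u y ^ (p / ((k:ℝ) + 2)) ∂μ
        = ∫⁻ y in Q, ENNReal.ofReal |f y| ^ (p / ((k:ℝ) + 2)) * ENNReal.ofReal (σ y) := by
      rw [hμ, restrict_withDensity hQ', lintegral_withDensity_eq_lintegral_mul₀ hσm.restrict
        (hum.pow_const _).aemeasurable]
      exact lintegral_congr fun x => mul_comm _ _
    by_cases hx : x ∈ Q
    · simp only [hx, iSup_pos, indicator_of_mem]
      rw [e1, e2, ← ENNReal.rpow_mul]
      congr 1
      field_simp
    · simp [hx, hk]
  have hFm : Measurable fun x => F x ^ p :=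
    measurable_of_tendsto_metrizable hNm (tendsto_pi_nhds.mpr hlim)
  have hLF : ∫⁻ x, F x ^ p * ENNReal.ofReal (σ x) = ∫⁻ x, F x ^ p ∂μ := by
    rw [hμ, lintegral_withDensity_eq_lintegral_mul₀ hσm hFm.aemeasurable]
    exact lintegral_congr fun x => mul_comm _ _
  have hmain : ∫⁻ x, F x ^ p ∂μ ≤ ENNReal.ofReal (Real.exp 1) * ∫⁻ x, u x ^ p ∂μ := by
    calc ∫⁻ x, F x ^ p ∂μ = ∫⁻ x, liminf (fun k => N k x) atTop ∂μ :=
          lintegral_congr fun x => (hlim x).liminf_eq.symm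
      _ ≤ liminf (fun k => ∫⁻ x, N k x ∂μ) atTop := lintegral_liminf_le hNm
      _ ≤ liminf (fun k : ℕ => ENNReal.ofReal (((k:ℝ) + 2) / ((k:ℝ) + 2 - 1)) ^ ((k:ℝ) + 2)
            * ∫⁻ x, u x ^ p ∂μ) atTop :=
          liminf_le_liminf (Eventually.of_forall hNint)
      _ = _ := (ENNReal.Tendsto.mul_const aux_const (Or.inr htop)).liminf_eq
  rw [hLF]
  calc (∫⁻ x, F x ^ p ∂μ) ^ (1 / p)
      ≤ (ENNReal.ofReal (Real.exp 1) * ∫⁻ x, u x ^ p ∂μ) ^ (1 / p) :=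
        ENNReal.rpow_le_rpow hmain hp0
    _ = _ := by
        rw [ENNReal.mul_rpow_of_nonneg _ _ hp0,
          ENNReal.ofReal_rpow_of_nonneg (Real.exp_pos _).le hp0, Real.exp_one_rpow]
end
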